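/- Let k ∈ ℝ² and let λ ∈ ℝ satisfy λ ≠ ‖ξ_m + k‖² for every m ∈ ℤ². Then there exists L ∈ ℝ such that the expression ∑_{m ∈ ℤ², ‖ξ_m + k‖ ≤ r} 1/(‖ξ_m + k‖² − λ) − (√3·a²/(4π))·ln r converges to L as r → ∞. (This is the existence of the renormalized lattice Green's function g_λ(0, k); the constant √3·a²/(4π) equals 2π divided by the area 8π²/(√3·a²) of the Brillouin zone.) -/

import Mathlib

open Real

noncomputable section

/-- ℝ² with the Euclidean norm. -/
abbrev E2 := EuclideanSpace ℝ (Fin 2)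

/-- Build a vector in ℝ². -/
def vec (x y : ℝ) : E2 := (WithLp.equiv 2 _).symm ![x, y]

/-- Dual basis vector k₁ = (4π/(a√3))(1/2, √3/2). -/
def k1 (a : ℝ) : E2 := (4 * π / (a * Real.sqrt 3)) • vec (1/2) (Real.sqrt 3 / 2)

/-- Dual basis vector k₂ = (4π/(a√3))(1/2, −√3/2). -/
def k2 (a : ℝ) : E2 := (4 * π / (a * Real.sqrt 3)) • vec (1/2) (-(Real.sqrt 3) / 2)

/-- Dual lattice vector ξ_m = m₁k₁ + m₂k₂. -/
def xiv (a : ℝ) (m : ℤ × ℤ) : E2 := (m.1 : ℝ) • k1 a + (m.2 : ℝ) • k2 a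

/-- The Dirac point K = (2/3)k₁ + (1/3)k₂. -/
def KD (a : ℝ) : E2 := (2/3 : ℝ) • k1 a + (1/3 : ℝ) • k2 a

/-- Lattice basis vector v₁ = a(√3/2, 1/2). -/
def v1 (a : ℝ) : E2 := a • vec (Real.sqrt 3 / 2) (1/2)

/-- Lattice basis vector v₂ = a(√3/2, −1/2). -/
def v2 (a : ℝ) : E2 := a • vec (Real.sqrt 3 / 2) (-(1/2))

/-- x₀ = (2/3)(v₁ + v₂). -/
def x0 (a : ℝ) : E2 := (2/3 : ℝ) • (v1 a + v2 a)

/-- Rotation of ℝ² by 2π/3, i.e. the matrix (1/2)[[−1, −√3], [√3, −1]]. -/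
def Rrot (v : E2) : E2 :=
  vec ((-v 0 - Real.sqrt 3 * v 1) / 2) ((Real.sqrt 3 * v 0 - v 1) / 2)

/-- T(m₁, m₂) = (−m₁ + m₂ − 1, −m₁ − 1). -/
def T (m : ℤ × ℤ) : ℤ × ℤ := (-m.1 + m.2 - 1, -m.1 - 1)

set_option maxHeartbeats 1000000 in
open Filter Topology in
/-- If the counting function of `x` is `C r² + O(r)`, then the cutoff sums of `1 / (x² - lam)` grow
like `2 C log r` up to a convergent term. -/
theorem exists_tendsto_sum_sub_log {ι : Type*} (x : ι → ℝ) (C B lam : ℝ)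
    (hfin : ∀ r : ℝ, {i | x i ≤ r}.Finite)
    (hcard : ∀ r : ℝ, 1 ≤ r → |((hfin r).toFinset.card : ℝ) - C * r ^ 2| ≤ B * r) :
    ∃ L : ℝ, Tendsto (fun r : ℝ =>
      (∑ i ∈ (hfin r).toFinset, 1 / (x i ^ 2 - lam)) - 2 * C * log r) atTop (𝓝 L) := by
  classical
  set N : ℝ → ℝ := fun r => ((hfin r).toFinset.card : ℝ) with hN
  set h : ℝ → ℝ := fun t => 1 / (t ^ 2 - lam) with hh
  set S : ℝ → ℝ := fun r => ∑ i ∈ (hfin r).toFinset, h (x i) with hS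
  have hB : 0 ≤ B := by simpa using (abs_nonneg _).trans (hcard 1 le_rfl)
  have shell : ∀ r s : ℝ, r ≤ s → ∃ D : Finset ι, (∀ i ∈ D, r < x i ∧ x i ≤ s) ∧
      (D.card : ℝ) = N s - N r ∧ S s - S r = ∑ i ∈ D, h (x i) := by
    intro r s hrs
    have hsub : (hfin r).toFinset ⊆ (hfin s).toFinset := by
      intro i hi
      simp only [Set.Finite.mem_toFinset, Set.mem_ofPred_eq] at hi ⊢
      exact hi.trans hrs
    refine ⟨(hfin s).toFinset \ (hfin r).toFinset, ?_, ?_, ?_⟩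
    · intro i hi
      simp only [Finset.mem_sdiff, Set.Finite.mem_toFinset, Set.mem_ofPred_eq, not_le] at hi
      exact ⟨hi.2, hi.1⟩
    · rw [Finset.card_sdiff_of_subset hsub, Nat.cast_sub (Finset.card_le_card hsub)]
    · simp only [hS]
      rw [← Finset.sum_sdiff hsub (f := fun i => h (x i))]
      ring
  obtain ⟨n₀, hn₀⟩ := exists_nat_ge (1 + 2 * |lam|)
  have big : ∀ t : ℝ, (n₀ : ℝ) ≤ t → 1 ≤ t ∧ t ^ 2 / 2 ≤ t ^ 2 - lam := by
    intro t ht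
    have h0 := abs_nonneg lam
    have h1 : 1 ≤ t := by linarith
    refine ⟨h1, ?_⟩
    nlinarith [le_abs_self lam]
  have hpos : ∀ t : ℝ, (n₀ : ℝ) ≤ t → 0 ≤ h t ∧ h t ≤ 2 / t ^ 2 := by
    intro t ht
    obtain ⟨h1, h2⟩ := big t ht
    have h3 : 0 < t ^ 2 := by positivity
    refine ⟨one_div_nonneg.2 (by linarith), ?_⟩
    simp only [hh]
    rw [div_le_div_iff₀ (by linarith) h3]
    linarith
  have hdiff : ∀ n t : ℝ, (n₀ : ℝ) ≤ n → n ≤ t → t ≤ n + 1 → |h t - h n| ≤ 12 / n ^ 3 := by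
    intro n t hn hnt htn
    obtain ⟨h1, h2⟩ := big n hn
    obtain ⟨h1', h2'⟩ := big t (hn.trans hnt)
    have hn2 : 0 < n ^ 2 := by positivity
    have hnt2 : n ^ 2 ≤ t ^ 2 := by gcongr
    have hnt2' : n ^ 2 / 2 ≤ t ^ 2 - lam := by linarith
    have e : h t - h n = -((t ^ 2 - n ^ 2) / ((t ^ 2 - lam) * (n ^ 2 - lam))) := by
      simp only [hh]
      have : t ^ 2 - lam ≠ 0 := by linarith
      have : n ^ 2 - lam ≠ 0 := by linarith
      field_simp
      ring
    rw [e, abs_neg, abs_of_nonneg (div_nonneg (by linarith) (mul_nonneg (by linarith) (by linarith)))]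
    calc (t ^ 2 - n ^ 2) / ((t ^ 2 - lam) * (n ^ 2 - lam))
        ≤ (3 * n) / ((n ^ 2 / 2) * (n ^ 2 / 2)) := by
          gcongr
          · nlinarith
          · linarith
      _ = 12 / n ^ 3 := by field_simp; ring
  set K : ℝ := 3 * |C| + 3 * B with hK
  have hK0 : 0 ≤ K := by positivity
  have hcount : ∀ n t : ℝ, (n₀ : ℝ) ≤ n → n ≤ t → t ≤ n + 1 → N t - N n ≤ K * n := by
    intro n t hn hnt htn
    have h1 := (big n hn).1
    have a1 := abs_le.1 (hcard n h1)
    have a2 := abs_le.1 (hcard t (h1.trans hnt))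
    have a3 : C * (t ^ 2 - n ^ 2) ≤ |C| * (3 * n) := by
      have : 0 ≤ t ^ 2 - n ^ 2 := by nlinarith
      exact mul_le_mul (le_abs_self C) (by nlinarith) this (abs_nonneg C)
    have a4 : B * t ≤ B * (2 * n) := by gcongr; linarith
    simp only [hN, hK]
    nlinarith
  have hlog : ∀ n t : ℝ, 1 ≤ n → n ≤ t → t ≤ n + 1 → 0 ≤ log t - log n ∧ log t - log n ≤ 1 / n := by
    intro n t h1 hnt htn
    have hn0 : 0 < n := by linarith
    rw [← log_div (by linarith) (by linarith)]
    refine ⟨log_nonneg ((one_le_div hn0).2 hnt),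
      (log_le_sub_one_of_pos (div_pos (by linarith) hn0)).trans ?_⟩
    rw [div_sub_one hn0.ne']
    gcongr
    linarith
  set G : ℝ → ℝ := fun r => S r - 2 * C * log r with hG
  set u : ℕ → ℝ := fun n => G n - (N n - C * (n : ℝ) ^ 2) * h n with hu
  set M : ℝ := K * 12 + |C| * (2 * (1 + 2 * |lam|) + 2) + 24 * B with hM
  have step : ∀ n : ℕ, n₀ ≤ n → |u (n + 1) - u n| ≤ M * (1 / (n : ℝ) ^ 2) := by
    intro n hn
    have hn' : (n₀ : ℝ) ≤ n := by exact_mod_cast hn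
    obtain ⟨h1, h2⟩ := big n hn'
    have hn0 : (0 : ℝ) < n := by linarith
    obtain ⟨D, hD, hDc, hDs⟩ := shell n (n + 1) (by linarith)
    have e : u (n + 1) - u n = (∑ i ∈ D, (h (x i) - h n))
        + C * ((2 * n + 1) * h n - 2 * (log (n + 1) - log n))
        + (N (n + 1) - C * ((n : ℝ) + 1) ^ 2) * (h n - h (n + 1)) := by
      rw [Finset.sum_sub_distrib, ← hDs, Finset.sum_const, nsmul_eq_mul, hDc]
      simp only [hu, hG]
      push_cast
      ring
    have b1 : |∑ i ∈ D, (h (x i) - h n)| ≤ K * 12 * (1 / (n : ℝ) ^ 2) := by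
      calc |∑ i ∈ D, (h (x i) - h n)| ≤ ∑ i ∈ D, |h (x i) - h n| := Finset.abs_sum_le_sum_abs _ _
        _ ≤ ∑ i ∈ D, 12 / (n : ℝ) ^ 3 :=
          Finset.sum_le_sum fun i hi => hdiff n (x i) hn' (hD i hi).1.le (hD i hi).2
        _ = (N (n + 1) - N n) * (12 / (n : ℝ) ^ 3) := by rw [Finset.sum_const, nsmul_eq_mul, hDc]
        _ ≤ (K * n) * (12 / (n : ℝ) ^ 3) := by
          gcongr
          exact hcount n (n + 1) hn' (by linarith) le_rfl
        _ = K * 12 * (1 / (n : ℝ) ^ 2) := by field_simp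
    have b2 : |C * ((2 * n + 1) * h n - 2 * (log (n + 1) - log n))|
        ≤ |C| * (2 * (1 + 2 * |lam|) + 2) * (1 / (n : ℝ) ^ 2) := by
      rw [abs_mul, mul_assoc]
      gcongr
      have c1 : |(2 * n + 1) * h n - 2 / n| ≤ 2 * (1 + 2 * |lam|) * (1 / (n : ℝ) ^ 2) := by
        have hne : (n : ℝ) ^ 2 - lam ≠ 0 := by nlinarith
        have e1 : (2 * n + 1) * h n - 2 / n = (n + 2 * lam) / n * h n := by
          simp only [hh]
          field_simp
          ring
        rw [e1, abs_mul, abs_of_nonneg (hpos n hn').1, abs_div, abs_of_pos hn0]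
        have e2 : |(n : ℝ) + 2 * lam| / n ≤ 1 + 2 * |lam| := by
          rw [div_le_iff₀ hn0]
          have := abs_add_le (n : ℝ) (2 * lam)
          rw [abs_mul, abs_of_pos hn0, abs_two] at this
          nlinarith [abs_nonneg lam]
        calc |(n : ℝ) + 2 * lam| / n * h n ≤ (1 + 2 * |lam|) * (2 / (n : ℝ) ^ 2) :=
              mul_le_mul e2 (hpos n hn').2 (hpos n hn').1 (by positivity)
          _ = _ := by ring
      have c2 : |2 / (n : ℝ) - 2 * (log (n + 1) - log n)| ≤ 2 * (1 / (n : ℝ) ^ 2) := by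
        have d1 := (hlog n (n + 1) h1 (by linarith) le_rfl).2
        have d2 : 1 / ((n : ℝ) + 1) ≤ log (n + 1) - log n := by
          rw [← log_div (by linarith) (by linarith)]
          refine le_trans (le_of_eq ?_) (one_sub_inv_le_log_of_pos (by positivity))
          field_simp
          ring
        have d3 : 1 / (n : ℝ) - 1 / ((n : ℝ) + 1) ≤ 1 / (n : ℝ) ^ 2 := by
          rw [div_sub_div _ _ hn0.ne' (by linarith), div_le_div_iff₀ (by positivity) (by positivity)]
          nlinarith
        have d4 : 2 / (n : ℝ) = 2 * (1 / n) := by ring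
        rw [abs_le, d4]
        have : 0 ≤ 1 / (n : ℝ) ^ 2 := by positivity
        constructor <;> linarith
      calc _ = |((2 * n + 1) * h n - 2 / n) + (2 / (n : ℝ) - 2 * (log (n + 1) - log n))| := by
            congr 1; ring
        _ ≤ _ := (abs_add_le _ _).trans (by linarith)
    have b3 : |(N (n + 1) - C * ((n : ℝ) + 1) ^ 2) * (h n - h (n + 1))|
        ≤ 24 * B * (1 / (n : ℝ) ^ 2) := by
      rw [abs_mul, abs_sub_comm (h n)]
      calc _ ≤ (B * (n + 1)) * (12 / (n : ℝ) ^ 3) :=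
            mul_le_mul (hcard _ (by linarith)) (hdiff n (n + 1) hn' (by linarith) le_rfl)
              (abs_nonneg _) (by positivity)
        _ ≤ (B * (2 * n)) * (12 / (n : ℝ) ^ 3) := by gcongr; linarith
        _ = _ := by field_simp; ring
    rw [e]
    refine (abs_add_three _ _ _).trans ?_
    rw [hM]
    linarith
  have hucauchy : CauchySeq u := by
    have hsum : Summable fun n : ℕ => M * (1 / ((n + n₀ : ℕ) : ℝ) ^ 2) :=
      ((summable_nat_add_iff n₀).2 (Real.summable_one_div_nat_pow.2 one_lt_two)).mul_left M
    have := cauchySeq_of_dist_le_of_summable (f := fun n => u (n + n₀)) _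
      (fun n => by
        rw [dist_comm, Real.dist_eq, Nat.succ_eq_add_one, add_right_comm]
        exact step (n + n₀) (Nat.le_add_left _ _)) hsum
    exact (cauchySeq_shift n₀).1 this
  obtain ⟨L, hL⟩ := cauchySeq_tendsto_of_complete hucauchy
  refine ⟨L, ?_⟩
  have hinv : Tendsto (fun n : ℕ => 1 / (n : ℝ)) atTop (𝓝 0) := tendsto_one_div_atTop_nhds_zero_nat
  have hE : Tendsto (fun n : ℕ => (N n - C * (n : ℝ) ^ 2) * h n) atTop (𝓝 0) := by
    refine squeeze_zero_norm' (a := fun n : ℕ => 2 * B * (1 / (n : ℝ))) ?_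
      (by simpa using hinv.const_mul (2 * B))
    filter_upwards [eventually_ge_atTop n₀] with n hn
    have hn' : (n₀ : ℝ) ≤ n := by exact_mod_cast hn
    have h1 := (big n hn').1
    rw [norm_eq_abs, abs_mul, abs_of_nonneg (hpos n hn').1]
    calc _ ≤ (B * n) * (2 / (n : ℝ) ^ 2) :=
          mul_le_mul (hcard _ h1) (hpos n hn').2 (hpos n hn').1 (by positivity)
      _ = _ := by field_simp
  have hGnat : Tendsto (fun n : ℕ => G n) atTop (𝓝 L) := by
    simpa [hu] using hL.add hE
  have hfloor : Tendsto (fun r : ℝ => ⌊r⌋₊) atTop atTop := tendsto_nat_floor_atTop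
  have hgap : Tendsto (fun r : ℝ => G r - G ⌊r⌋₊) atTop (𝓝 0) := by
    refine squeeze_zero_norm' (a := fun r : ℝ => (2 * K + 2 * |C|) * (1 / (⌊r⌋₊ : ℝ))) ?_
      (by simpa using (hinv.comp hfloor).const_mul (2 * K + 2 * |C|))
    filter_upwards [hfloor.eventually_ge_atTop n₀, eventually_ge_atTop 0] with r hr hr0
    set n := ⌊r⌋₊
    have hn' : (n₀ : ℝ) ≤ n := by exact_mod_cast hr
    have h1 := (big n hn').1
    have hnr : (n : ℝ) ≤ r := Nat.floor_le hr0
    have hrn : r ≤ n + 1 := (Nat.lt_floor_add_one r).le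
    obtain ⟨D, hD, hDc, hDs⟩ := shell n r hnr
    have b1 : |∑ i ∈ D, h (x i)| ≤ 2 * K * (1 / (n : ℝ)) := by
      calc |∑ i ∈ D, h (x i)| ≤ ∑ i ∈ D, |h (x i)| := Finset.abs_sum_le_sum_abs _ _
        _ ≤ ∑ i ∈ D, 2 / (n : ℝ) ^ 2 := Finset.sum_le_sum fun i hi => by
          have hi1 := (hD i hi).1.le
          rw [abs_of_nonneg (hpos _ (hn'.trans hi1)).1]
          refine (hpos _ (hn'.trans hi1)).2.trans ?_
          gcongr
        _ = (N r - N n) * (2 / (n : ℝ) ^ 2) := by rw [Finset.sum_const, nsmul_eq_mul, hDc]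
        _ ≤ (K * n) * (2 / (n : ℝ) ^ 2) := by
          gcongr
          exact hcount n r hn' hnr hrn
        _ = _ := by field_simp
    have b2 : |2 * C * (log r - log n)| ≤ 2 * |C| * (1 / (n : ℝ)) := by
      obtain ⟨l1, l2⟩ := hlog n r h1 hnr hrn
      rw [abs_mul, abs_mul, abs_two, abs_of_nonneg l1]
      gcongr
    have e : G r - G n = (∑ i ∈ D, h (x i)) - 2 * C * (log r - log n) := by
      rw [← hDs]
      simp only [hG]
      ring
    rw [norm_eq_abs, e]
    refine (abs_sub _ _).trans ?_
    linarith
  simpa using hgap.add (hGnat.comp hfloor)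

section LatticeCounting

open MeasureTheory Module

/-- Lattice points of a planar lattice in a disc are counted by the ratio of the areas of the disc
and of a fundamental domain, up to an error linear in the radius. -/
theorem abs_card_lattice_points_sub_le (b : Basis (Fin 2) ℝ E2) (k : E2)
    (hfin : ∀ r : ℝ, {m : ℤ × ℤ | ‖((m.1 : ℝ) • b 0 + (m.2 : ℝ) • b 1) + k‖ ≤ r}.Finite) :
    ∃ B : ℝ, ∀ r : ℝ, 1 ≤ r →
      |((hfin r).toFinset.card : ℝ) - π / volume.real (ZSpan.fundamentalDomain b) * r ^ 2|
        ≤ B * r := by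
  set F := ZSpan.fundamentalDomain b with hF
  set c : ℤ × ℤ → E2 := fun m => ((m.1 : ℝ) • b 0 + (m.2 : ℝ) • b 1) + k with hc
  obtain ⟨d, hd⟩ := (ZSpan.fundamentalDomain_isBounded b).exists_norm_le
  have hd0 : 0 ≤ d := (norm_nonneg _).trans (hd _ (ZSpan.fract_mem_fundamentalDomain b 0))
  have hFmeas : MeasurableSet F := ZSpan.fundamentalDomain_measurableSet b
  have hFpos : 0 < volume.real F := by
    refine ENNReal.toReal_pos (ZSpan.measure_fundamentalDomain_ne_zero b) ?_
    exact (ZSpan.fundamentalDomain_isBounded b).measure_lt_top.ne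
  set P : ℤ × ℤ → Set E2 := fun m => (fun y => y - c m) ⁻¹' F with hP
  have hPmem : ∀ m y, y ∈ P m ↔ (⌊b.repr (y - k) 0⌋, ⌊b.repr (y - k) 1⌋) = m := by
    intro m y
    have e : y - c m = (y - k) - ((m.1 : ℝ) • b 0 + (m.2 : ℝ) • b 1) := by simp only [hc]; abel
    simp only [hP, hF, Set.mem_preimage, ZSpan.mem_fundamentalDomain, Fin.forall_fin_two, e,
      map_sub, map_add, map_smul, Basis.repr_self, Prod.ext_iff, Int.floor_eq_iff, Set.mem_Ico]
    simp only [Finsupp.coe_sub, Finsupp.coe_add, Finsupp.coe_smul, Pi.sub_apply, Pi.add_apply,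
      Pi.smul_apply, Finsupp.single_apply, smul_eq_mul]
    simp
    constructor <;> rintro ⟨⟨_, _⟩, _, _⟩ <;> refine ⟨⟨?_, ?_⟩, ?_, ?_⟩ <;> linarith
  have hPnorm : ∀ m y, y ∈ P m → ‖y - c m‖ ≤ d := fun m y hy => hd _ hy
  have hPvol : ∀ m, volume.real (P m) = volume.real F := by
    intro m
    simp only [hP, Measure.real, sub_eq_add_neg, measure_preimage_add_right]
  have hPfin : ∀ m, volume (P m) ≠ ⊤ := by
    intro m h
    have := hPvol m ▸ hFpos
    simp [Measure.real, h] at this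
  have hPmeas : ∀ m, MeasurableSet (P m) := fun m => (measurable_id.sub_const _) hFmeas
  have hball : ∀ r : ℝ, 0 ≤ r → volume.real (Metric.closedBall (0 : E2) r) = π * r ^ 2 := by
    intro r hr
    rw [Measure.real, EuclideanSpace.volume_closedBall_fin_two]
    simp [ENNReal.toReal_ofReal hr, ENNReal.toReal_ofReal pi_pos.le, mul_comm]
  have hcells : ∀ r, volume.real (⋃ m ∈ (hfin r).toFinset, P m)
      = (hfin r).toFinset.card * volume.real F := by
    intro r
    rw [measureReal_biUnion_finset (h := ?_)]
    · simp [hPvol]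
    · intro m _ n _ hmn
      refine Set.disjoint_left.2 fun y hm hn => hmn ?_
      rw [← (hPmem m y).1 hm, (hPmem n y).1 hn]
    · exact fun m _ => hPmeas m
    · exact fun m _ => hPfin m
  have upper : ∀ r : ℝ, 0 ≤ r → (hfin r).toFinset.card * volume.real F ≤ π * (r + d) ^ 2 := by
    intro r hr
    rw [← hcells, ← hball _ (by positivity)]
    refine measureReal_mono ?_ measure_closedBall_lt_top.ne
    refine Set.iUnion₂_subset fun m hm y hy => ?_
    have hm' : ‖c m‖ ≤ r := by simpa using hm
    rw [mem_closedBall_zero_iff]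
    have := norm_add_le (y - c m) (c m)
    rw [sub_add_cancel] at this
    linarith [hPnorm m y hy]
  have lower : ∀ r : ℝ, d ≤ r → π * (r - d) ^ 2 ≤ (hfin r).toFinset.card * volume.real F := by
    intro r hr
    rw [← hcells, ← hball _ (by linarith)]
    refine measureReal_mono ?_ ?_
    · intro y hy
      rw [mem_closedBall_zero_iff] at hy
      have hym := (hPmem _ y).2 rfl
      refine Set.mem_iUnion₂.2 ⟨_, ?_, hym⟩
      have h1 := norm_sub_le y (y - c (⌊b.repr (y - k) 0⌋, ⌊b.repr (y - k) 1⌋))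
      rw [sub_sub_cancel] at h1
      have : ‖c (⌊b.repr (y - k) 0⌋, ⌊b.repr (y - k) 1⌋)‖ ≤ r := by linarith [hPnorm _ y hym]
      simpa using this
    · refine ne_top_of_le_ne_top ?_ (measure_biUnion_finset_le _ _)
      exact ENNReal.sum_ne_top.2 fun m _ => hPfin m
  refine ⟨π * (2 * d + d ^ 2) / volume.real F, fun r hr => ?_⟩
  set N : ℝ := ((hfin r).toFinset.card : ℝ) with hN
  have hu := upper r (by linarith)
  have hl : π * (r ^ 2 - (2 * d + d ^ 2) * r) ≤ N * volume.real F := by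
    rcases le_total d r with h | h
    · refine le_trans ?_ (lower r h)
      gcongr
      nlinarith [sq_nonneg d]
    · refine le_trans (mul_nonpos_of_nonneg_of_nonpos pi_pos.le ?_) (by positivity)
      nlinarith [sq_nonneg d]
  have hu' : N * volume.real F ≤ π * (r ^ 2 + (2 * d + d ^ 2) * r) := by
    refine hu.trans ?_
    gcongr
    nlinarith [sq_nonneg d]
  have e : N - π / volume.real F * r ^ 2 = (N * volume.real F - π * r ^ 2) / volume.real F := by
    field_simp
  rw [e, abs_div, abs_of_pos hFpos, div_mul_eq_mul_div]
  gcongr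
  rw [abs_le]
  constructor <;> nlinarith

theorem measureReal_fundamentalDomain_eq_abs_det (b : Basis (Fin 2) ℝ E2) :
    volume.real (ZSpan.fundamentalDomain b) = |b 0 0 * b 1 1 - b 1 0 * b 0 1| := by
  let e := EuclideanSpace.basisFun (Fin 2) ℝ
  have he : volume.real (ZSpan.fundamentalDomain e.toBasis) = 1 := by
    rw [Measure.real, measure_congr (ZSpan.fundamentalDomain_ae_parallelepiped e.toBasis volume),
      OrthonormalBasis.coe_toBasis, OrthonormalBasis.volume_parallelepiped, ENNReal.toReal_one]
  rw [ZSpan.measureReal_fundamentalDomain b volume e.toBasis, he, mul_one, Basis.det_apply,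
    Matrix.det_fin_two]
  simp [e, Basis.toMatrix_apply]

end LatticeCounting

theorem xiv_basis_det {a : ℝ} (ha : 0 < a) :
    k1 a 0 * k2 a 1 - k2 a 0 * k1 a 1 = -(8 * π ^ 2 / (√3 * a ^ 2)) := by
  have h3 : √3 * √3 = 3 := mul_self_sqrt (by norm_num)
  have : √3 ≠ 0 := by positivity
  simp [k1, k2, vec]
  field_simp
  ring

theorem linearIndependent_k1_k2 {a : ℝ} (ha : 0 < a) : LinearIndependent ℝ ![k1 a, k2 a] := by
  have hdet := xiv_basis_det ha
  have hne : k1 a 0 * k2 a 1 - k2 a 0 * k1 a 1 ≠ 0 := by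
    rw [hdet]
    exact neg_ne_zero.2 (by positivity)
  rw [LinearIndependent.pair_iff]
  intro s t hst
  have h0 : s * k1 a 0 + t * k2 a 0 = 0 := by simpa using congrArg (fun v : E2 => v 0) hst
  have h1 : s * k1 a 1 + t * k2 a 1 = 0 := by simpa using congrArg (fun v : E2 => v 1) hst
  constructor
  · refine (mul_eq_zero.1 (?_ : s * (k1 a 0 * k2 a 1 - k2 a 0 * k1 a 1) = 0)).resolve_right hne
    linear_combination k2 a 1 * h0 - k2 a 0 * h1
  · refine (mul_eq_zero.1 (?_ : t * (k1 a 0 * k2 a 1 - k2 a 0 * k1 a 1) = 0)).resolve_right hne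
    linear_combination k1 a 0 * h1 - k1 a 1 * h0

open Filter in
/-- existence of the renormalized lattice Green's function
g_λ(0, k): the cutoff sums minus (√3 a²/(4π))·ln r converge as r → ∞. -/
theorem stmt_16 (a : ℝ) (ha : 0 < a) (k : E2) (lam : ℝ)
    (hlam : ∀ m : ℤ × ℤ, lam ≠ ‖xiv a m + k‖ ^ 2)
    (hfin : ∀ r : ℝ, {m : ℤ × ℤ | ‖xiv a m + k‖ ≤ r}.Finite) :
    ∃ L : ℝ, Tendsto (fun r : ℝ =>
        (∑ m ∈ (hfin r).toFinset, 1 / (‖xiv a m + k‖ ^ 2 - lam))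
          - (Real.sqrt 3 * a ^ 2 / (4 * π)) * Real.log r)
      atTop (nhds L) := by
  let b : Module.Basis (Fin 2) ℝ E2 :=
    basisOfLinearIndependentOfCardEqFinrank (linearIndependent_k1_k2 ha) (by simp)
  have hb0 : b 0 = k1 a := by simp [b]
  have hb1 : b 1 = k2 a := by simp [b]
  have hfin' : ∀ r : ℝ,
      {m : ℤ × ℤ | ‖((m.1 : ℝ) • b 0 + (m.2 : ℝ) • b 1) + k‖ ≤ r}.Finite := by
    simpa only [hb0, hb1, xiv] using hfin
  obtain ⟨B, hB⟩ := abs_card_lattice_points_sub_le b k hfin'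
  simp only [measureReal_fundamentalDomain_eq_abs_det, hb0, hb1, xiv_basis_det ha, abs_neg] at hB
  rw [abs_of_nonneg (by positivity)] at hB
  have hC : √3 * a ^ 2 / (4 * π) = 2 * (π / (8 * π ^ 2 / (√3 * a ^ 2))) := by
    field_simp
    norm_num
  rw [hC]
  exact exists_tendsto_sum_sub_log (fun m => ‖xiv a m + k‖) _ B lam hfin hB
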